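/- Non-stationary phase kernel decay: Let S ⊂ ℝ² and V ⊂ ℝ² be compact sets, let c > 0, and let C_α ≥ 0 be constants for every multiindex α ∈ ℕ². Suppose Υ : ℝ² × ℝ² → ℝ is a function of (x,v), smooth in x, such that for all x ∈ S and v, ṽ ∈ V one has |∇_x[Υ(x,v) − Υ(x,ṽ)]| ≥ c|v − ṽ| and |∂_x^α[Υ(x,v) − Υ(x,ṽ)]| ≤ C_α |v − ṽ| for every multiindex α. Then for every positive integer j there is a constant C_j such that for every λ ≥ 1, every pair of functions B, B̃ : ℝ² × ℝ² → ℂ smooth in x, supported in {(x,v) : x ∈ S, v ∈ V}, with |∂_x^α B(x,v)| ≤ C_α and |∂_x^α B̃(x,v)| ≤ C_α for all α, and every v, ṽ ∈ V: | ∫_{ℝ²} B(x,v) conj(B̃(x,ṽ)) e^{iλ[Υ(x,v) − Υ(x,ṽ)]} dx | ≤ C_j (1 + λ|v − ṽ|)^{−2j}. -/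

import Mathlib

open MeasureTheory

/-- Partial derivative of `f : (Fin n → ℝ) → E` in the `i`-th coordinate. -/
noncomputable def pderivPi {n : ℕ} {E : Type*} [NormedAddCommGroup E] [NormedSpace ℝ E]
    (i : Fin n) (f : (Fin n → ℝ) → E) : (Fin n → ℝ) → E :=
  fun x => deriv (fun t => f (Function.update x i t)) (x i)

/-- Iterated partial derivative of multi-order `α : Fin n → ℕ`. -/
noncomputable def mpderivPi {n : ℕ} {E : Type*} [NormedAddCommGroup E] [NormedSpace ℝ E]
    (α : Fin n → ℕ) (f : (Fin n → ℝ) → E) : (Fin n → ℝ) → E :=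
  (List.finRange n).foldr (fun i g => (pderivPi i)^[α i] g) f

section PartialDerivatives

variable {n : ℕ} {E E' : Type*} [NormedAddCommGroup E] [NormedSpace ℝ E]
  [NormedAddCommGroup E'] [NormedSpace ℝ E']

theorem pderivPi_eq_fderiv {f : (Fin n → ℝ) → E} {x : Fin n → ℝ} (hf : DifferentiableAt ℝ f x)
    (i : Fin n) : pderivPi i f x = fderiv ℝ f x (Pi.single i 1) := by
  have hf' : HasFDerivAt f (fderiv ℝ f x) (Function.update x i (x i)) := by
    simpa using hf.hasFDerivAt
  exact (hf'.comp_hasDerivAt (x i) (hasDerivAt_update x i (x i))).deriv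

theorem ContDiff.pderivPi_eq_fderiv {f : (Fin n → ℝ) → E} (hf : ContDiff ℝ (⊤ : ℕ∞) f)
    (i : Fin n) : pderivPi i f = fun x => fderiv ℝ f x (Pi.single i 1) :=
  funext fun x => _root_.pderivPi_eq_fderiv (hf.differentiable (by simp) x) i

theorem ContDiff.pderivPi {f : (Fin n → ℝ) → E} (hf : ContDiff ℝ (⊤ : ℕ∞) f)
    (i : Fin n) : ContDiff ℝ (⊤ : ℕ∞) (pderivPi i f) := by
  rw [hf.pderivPi_eq_fderiv]
  exact (hf.fderiv_right (m := (⊤ : ℕ∞)) (by simp)).clm_apply contDiff_const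

theorem ContDiff.iterate_pderivPi {f : (Fin n → ℝ) → E} (hf : ContDiff ℝ (⊤ : ℕ∞) f)
    (i : Fin n) (k : ℕ) : ContDiff ℝ (⊤ : ℕ∞) ((_root_.pderivPi i)^[k] f) := by
  induction k with
  | zero => exact hf
  | succ k ih => rw [Function.iterate_succ_apply']; exact ih.pderivPi i

theorem ContDiff.pderivPi_comm {f : (Fin n → ℝ) → E} (hf : ContDiff ℝ (⊤ : ℕ∞) f)
    (i j : Fin n) :
    _root_.pderivPi i (_root_.pderivPi j f) = _root_.pderivPi j (_root_.pderivPi i f) := by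
  have key : ∀ i j : Fin n, ∀ x, _root_.pderivPi i (_root_.pderivPi j f) x =
      fderiv ℝ (fderiv ℝ f) x (Pi.single i 1) (Pi.single j 1) := by
    intro i j x
    have hd : DifferentiableAt ℝ (fderiv ℝ f) x :=
      (hf.fderiv_right (m := (⊤ : ℕ∞)) (by simp)).differentiable (by simp) x
    rw [(hf.pderivPi j).pderivPi_eq_fderiv, hf.pderivPi_eq_fderiv]
    dsimp only
    rw [fderiv_clm_apply hd (differentiableAt_const _)]
    simp
  funext x
  rw [key, key]
  have two_le : (2 : WithTop ℕ∞) ≤ ((⊤ : ℕ∞) : WithTop ℕ∞) := 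
    WithTop.coe_le_coe.2 le_top
  exact (hf.contDiffAt.isSymmSndFDerivAt (by simpa using two_le)) _ _

theorem ContDiff.pderivPi_iterate_comm {f : (Fin n → ℝ) → E} (hf : ContDiff ℝ (⊤ : ℕ∞) f)
    (i j : Fin n) (k : ℕ) :
    _root_.pderivPi i ((_root_.pderivPi j)^[k] f) =
      (_root_.pderivPi j)^[k] (_root_.pderivPi i f) := by
  induction k with
  | zero => rfl
  | succ k ih =>
    rw [Function.iterate_succ_apply', Function.iterate_succ_apply',
      (hf.iterate_pderivPi j k).pderivPi_comm, ih]

theorem mpderivPi_two (α : Fin 2 → ℕ) (f : (Fin 2 → ℝ) → E) :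
    mpderivPi α f = (pderivPi 0)^[α 0] ((pderivPi 1)^[α 1] f) := by
  simp [mpderivPi, List.finRange_succ]

theorem ContDiff.mpderivPi {f : (Fin 2 → ℝ) → E} (hf : ContDiff ℝ (⊤ : ℕ∞) f)
    (α : Fin 2 → ℕ) : ContDiff ℝ (⊤ : ℕ∞) (mpderivPi α f) := by
  rw [mpderivPi_two]
  exact (hf.iterate_pderivPi _ _).iterate_pderivPi _ _

theorem ContDiff.pderivPi_mpderivPi {f : (Fin 2 → ℝ) → E} (hf : ContDiff ℝ (⊤ : ℕ∞) f)
    (i : Fin 2) (α : Fin 2 → ℕ) :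
    _root_.pderivPi i (_root_.mpderivPi α f) = _root_.mpderivPi (α + Pi.single i 1) f := by
  rw [mpderivPi_two, mpderivPi_two]
  fin_cases i
  · simp [← Function.iterate_succ_apply']
  · simp [(hf.iterate_pderivPi 1 (α 1)).pderivPi_iterate_comm 1 0,
      ← Function.iterate_succ_apply']

theorem pderivPi_const_smul (a : ℝ) (f : (Fin n → ℝ) → E) (i : Fin n) :
    pderivPi i (fun x => a • f x) = fun x => a • pderivPi i f x :=
  funext fun x => deriv_fun_const_smul_field a fun t => f (Function.update x i t)

theorem mpderivPi_const_smul (a : ℝ) (f : (Fin 2 → ℝ) → E) (α : Fin 2 → ℕ) :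
    mpderivPi α (fun x => a • f x) = fun x => a • mpderivPi α f x := by
  have iter : ∀ (i : Fin 2) (k : ℕ) (f : (Fin 2 → ℝ) → E),
      (pderivPi i)^[k] (fun x => a • f x) = fun x => a • (pderivPi i)^[k] f x := by
    intro i k f
    induction k with
    | zero => rfl
    | succ k ih =>
      rw [Function.iterate_succ_apply', ih, pderivPi_const_smul, Function.iterate_succ_apply']
  rw [mpderivPi_two, iter, iter, mpderivPi_two]

theorem ContDiff.pderivPi_clm_comp {f : (Fin n → ℝ) → E} (hf : ContDiff ℝ (⊤ : ℕ∞) f)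
    (L : E →L[ℝ] E') (i : Fin n) :
    _root_.pderivPi i (fun x => L (f x)) = fun x => L (_root_.pderivPi i f x) := by
  have hL : ContDiff ℝ (⊤ : ℕ∞) (fun x => L (f x)) := L.contDiff.comp hf
  rw [hL.pderivPi_eq_fderiv, hf.pderivPi_eq_fderiv]
  funext x
  have := L.hasFDerivAt.comp x (hf.differentiable (by simp) x).hasFDerivAt
  exact congrArg (fun T => T (Pi.single i 1)) this.fderiv

theorem ContDiff.pderivPi_add {f g : (Fin n → ℝ) → E} (hf : ContDiff ℝ (⊤ : ℕ∞) f)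
    (hg : ContDiff ℝ (⊤ : ℕ∞) g) (i : Fin n) :
    _root_.pderivPi i (fun x => f x + g x) =
      fun x => _root_.pderivPi i f x + _root_.pderivPi i g x := by
  rw [(hf.add hg).pderivPi_eq_fderiv, hf.pderivPi_eq_fderiv, hg.pderivPi_eq_fderiv]
  funext x
  rw [fderiv_fun_add (hf.differentiable (by simp) x) (hg.differentiable (by simp) x)]
  rfl

theorem ContDiff.pderivPi_mul {f g : (Fin n → ℝ) → ℂ} (hf : ContDiff ℝ (⊤ : ℕ∞) f)
    (hg : ContDiff ℝ (⊤ : ℕ∞) g) (i : Fin n) :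
    _root_.pderivPi i (fun x => f x * g x) =
      fun x => _root_.pderivPi i f x * g x + f x * _root_.pderivPi i g x := by
  rw [(hf.mul hg).pderivPi_eq_fderiv, hf.pderivPi_eq_fderiv, hg.pderivPi_eq_fderiv]
  funext x
  rw [fderiv_fun_mul (hf.differentiable (by simp) x) (hg.differentiable (by simp) x)]
  simp
  ring

theorem pderivPi_eq_zero_of_eqOn_compl {S : Set (Fin n → ℝ)} (hS : IsClosed S)
    {f : (Fin n → ℝ) → E} (hf : ∀ x ∉ S, f x = 0) (i : Fin n) :
    ∀ x ∉ S, pderivPi i f x = 0 := by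
  intro x hx
  have h : f =ᶠ[nhds x] fun _ => 0 := by
    filter_upwards [hS.isOpen_compl.mem_nhds hx] with y hy using hf y hy
  rw [pderivPi_eq_fderiv (h.differentiableAt_iff.2 (differentiableAt_const _)), h.fderiv_eq]
  simp

end PartialDerivatives

section UniformBounds

variable {n : ℕ} {ι : Type*} {E E' : Type*} [NormedAddCommGroup E] [NormedSpace ℝ E]
  [NormedAddCommGroup E'] [NormedSpace ℝ E']

/-- All partial derivatives of order at most `k` of the functions `F a` are bounded on `S`,
uniformly in the parameter `a`. -/
def UniformPDerivBound (S : Set (Fin n → ℝ)) :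
    ℕ → (ι → (Fin n → ℝ) → E) → Prop
  | 0, F => ∃ M : ℝ, ∀ a, ∀ x ∈ S, ‖F a x‖ ≤ M
  | k + 1, F => (∃ M : ℝ, ∀ a, ∀ x ∈ S, ‖F a x‖ ≤ M) ∧
      ∀ i, UniformPDerivBound S k fun a => pderivPi i (F a)

/-- A family of smooth functions all of whose partial derivatives are bounded on `S`,
uniformly in the parameter. -/
structure UniformlySmooth (S : Set (Fin n → ℝ)) (F : ι → (Fin n → ℝ) → E) : Prop where
  contDiff : ∀ a, ContDiff ℝ (⊤ : ℕ∞) (F a)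
  bound : ∀ k, UniformPDerivBound S k F

variable {S : Set (Fin n → ℝ)}

theorem UniformPDerivBound.add {k : ℕ} {F G : ι → (Fin n → ℝ) → E}
    (hF : ∀ a, ContDiff ℝ (⊤ : ℕ∞) (F a)) (hG : ∀ a, ContDiff ℝ (⊤ : ℕ∞) (G a))
    (hFk : UniformPDerivBound S k F) (hGk : UniformPDerivBound S k G) :
    UniformPDerivBound S k fun a x => F a x + G a x := by
  induction k generalizing F G with
  | zero =>
    obtain ⟨M, hM⟩ := hFk
    obtain ⟨M', hM'⟩ := hGk
    exact ⟨M + M', fun a x hx => norm_add_le_of_le (hM a x hx) (hM' a x hx)⟩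
  | succ k ih =>
    obtain ⟨⟨M, hM⟩, hF'⟩ := hFk
    obtain ⟨⟨M', hM'⟩, hG'⟩ := hGk
    refine ⟨⟨M + M', fun a x hx => norm_add_le_of_le (hM a x hx) (hM' a x hx)⟩, fun i => ?_⟩
    simp only [(hF _).pderivPi_add (hG _) i]
    exact ih (fun a => (hF a).pderivPi i) (fun a => (hG a).pderivPi i) (hF' i) (hG' i)

namespace UniformlySmooth

theorem pderivPi {F : ι → (Fin n → ℝ) → E} (hF : UniformlySmooth S F) (i : Fin n) :
    UniformlySmooth S fun a => pderivPi i (F a) :=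
  ⟨fun a => (hF.contDiff a).pderivPi i, fun k => (hF.bound (k + 1)).2 i⟩

theorem clm_comp {F : ι → (Fin n → ℝ) → E} (hF : UniformlySmooth S F) (L : E →L[ℝ] E') :
    UniformlySmooth S fun a x => L (F a x) := by
  refine ⟨fun a => L.contDiff.comp (hF.contDiff a), fun k => ?_⟩
  have zeroth : ∀ {F : ι → (Fin n → ℝ) → E}, UniformlySmooth S F →
      ∃ M : ℝ, ∀ a, ∀ x ∈ S, ‖L (F a x)‖ ≤ M := by
    intro F hF
    obtain ⟨M, hM⟩ := hF.bound 0
    exact ⟨‖L‖ * M, fun a x hx => (L.le_opNorm _).trans (by gcongr; exact hM a x hx)⟩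
  induction k generalizing F with
  | zero => exact zeroth hF
  | succ k ih =>
    refine ⟨zeroth hF, fun i => ?_⟩
    simp only [(hF.contDiff _).pderivPi_clm_comp L i]
    exact ih (hF.pderivPi i)

theorem add {F G : ι → (Fin n → ℝ) → E} (hF : UniformlySmooth S F)
    (hG : UniformlySmooth S G) : UniformlySmooth S fun a x => F a x + G a x :=
  ⟨fun a => (hF.contDiff a).add (hG.contDiff a), fun k =>
    (hF.bound k).add hF.contDiff hG.contDiff (hG.bound k)⟩

theorem zero : UniformlySmooth S fun (_ : ι) (_ : Fin n → ℝ) => (0 : E) := by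
  refine ⟨fun _ => contDiff_const, fun k => ?_⟩
  induction k with
  | zero => exact ⟨0, by simp⟩
  | succ k ih =>
    refine ⟨⟨0, by simp⟩, fun i => ?_⟩
    have h : _root_.pderivPi i (fun _ : Fin n → ℝ => (0 : E)) = fun _ => 0 := by
      funext x; simp [_root_.pderivPi]
    simpa only [h] using ih

theorem sum {κ : Type*} (s : Finset κ) {F : κ → ι → (Fin n → ℝ) → E}
    (hF : ∀ l, UniformlySmooth S (F l)) : UniformlySmooth S fun a x => ∑ l ∈ s, F l a x := by
  classical
  induction s using Finset.induction_on with
  | empty => simpa using zero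
  | insert l s hl ih => simpa only [Finset.sum_insert hl] using (hF l).add ih

theorem mul {F G : ι → (Fin n → ℝ) → ℂ} (hF : UniformlySmooth S F)
    (hG : UniformlySmooth S G) : UniformlySmooth S fun a x => F a x * G a x := by
  refine ⟨fun a => (hF.contDiff a).mul (hG.contDiff a), fun k => ?_⟩
  have zeroth : ∀ {F G : ι → (Fin n → ℝ) → ℂ}, UniformlySmooth S F → UniformlySmooth S G →
      ∃ M : ℝ, ∀ a, ∀ x ∈ S, ‖F a x * G a x‖ ≤ M := by
    intro F G hF hG
    obtain ⟨M, hM⟩ := hF.bound 0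
    obtain ⟨M', hM'⟩ := hG.bound 0
    exact ⟨M * M', fun a x hx => norm_mul_le_of_le (hM a x hx) (hM' a x hx)⟩
  induction k generalizing F G with
  | zero => exact zeroth hF hG
  | succ k ih =>
    refine ⟨zeroth hF hG, fun i => ?_⟩
    simp only [(hF.contDiff _).pderivPi_mul (hG.contDiff _) i]
    exact (ih (hF.pderivPi i) hG).add
      (fun a => ((hF.contDiff a).pderivPi i).mul (hG.contDiff a))
      (fun a => (hF.contDiff a).mul ((hG.contDiff a).pderivPi i))
      (ih hF (hG.pderivPi i))

theorem of_mpderivPi {S : Set (Fin 2 → ℝ)} {F : ι → (Fin 2 → ℝ) → E}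
    (hF : ∀ a, ContDiff ℝ (⊤ : ℕ∞) (F a)) (M : (Fin 2 → ℕ) → ℝ)
    (hM : ∀ α a, ∀ x ∈ S, ‖mpderivPi α (F a) x‖ ≤ M α) : UniformlySmooth S F := by
  refine ⟨hF, fun k => ?_⟩
  have key : ∀ α, UniformPDerivBound S k fun a => mpderivPi α (F a) := by
    induction k with
    | zero => exact fun α => ⟨M α, hM α⟩
    | succ k ih =>
      refine fun α => ⟨⟨M α, hM α⟩, fun i => ?_⟩
      simp only [(hF _).pderivPi_mpderivPi i α]
      exact ih _
  simpa [mpderivPi_two] using key 0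

end UniformlySmooth

end UniformBounds

section OscillatoryIntegral

open Complex

variable {n : ℕ} {S : Set (Fin n → ℝ)}

theorem contDiff_div_pow_of_eqOn_compl (hS : IsClosed S) {f g : (Fin n → ℝ) → ℂ}
    (hf : ContDiff ℝ (⊤ : ℕ∞) f) (hg : ContDiff ℝ (⊤ : ℕ∞) g) (hf0 : ∀ x ∉ S, f x = 0)
    (hg0 : ∀ x ∈ S, g x ≠ 0) (m : ℕ) : ContDiff ℝ (⊤ : ℕ∞) fun x => f x / g x ^ m := by
  rw [contDiff_iff_contDiffAt]
  intro x
  by_cases hx : x ∈ S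
  · simp only [div_eq_mul_inv]
    exact hf.contDiffAt.mul ((hg.contDiffAt.pow m).inv (pow_ne_zero m (hg0 x hx)))
  · refine (contDiffAt_const (c := (0 : ℂ))).congr_of_eventuallyEq ?_
    filter_upwards [hS.isOpen_compl.mem_nhds hx] with y hy
    simp [hf0 y hy]

theorem pderivPi_div_pow_of_eqOn_compl (hS : IsClosed S) {f g : (Fin n → ℝ) → ℂ}
    (hf : ContDiff ℝ (⊤ : ℕ∞) f) (hg : ContDiff ℝ (⊤ : ℕ∞) g) (hf0 : ∀ x ∉ S, f x = 0)
    (hg0 : ∀ x ∈ S, g x ≠ 0) (m : ℕ) (i : Fin n) (x : Fin n → ℝ) :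
    pderivPi i (fun x => f x / g x ^ m) x =
      pderivPi i f x / g x ^ m - m * (f x * pderivPi i g x / g x ^ (m + 1)) := by
  by_cases hx : x ∈ S
  · have hline : ∀ {h : (Fin n → ℝ) → ℂ}, ContDiff ℝ (⊤ : ℕ∞) h →
        HasDerivAt (fun t => h (Function.update x i t)) (pderivPi i h x) (x i) := by
      intro h hh
      have hx' : HasFDerivAt h (fderiv ℝ h x) (Function.update x i (x i)) := by
        simpa using (hh.differentiable (by simp) x).hasFDerivAt
      exact (hx'.comp_hasDerivAt (x i) (hasDerivAt_update x i (x i))).differentiableAt.hasDerivAt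
    have hgx := hg0 x hx
    have hd := ((hline hf).div ((hline hg).pow m) (by simpa using pow_ne_zero m hgx)).deriv
    refine hd.trans ?_
    simp only [Function.update_eq_self, Pi.pow_apply]
    rcases m with _ | m
    · simp
    · rw [Nat.add_sub_cancel]
      field_simp
      ring
  · have h0 : ∀ y ∉ S, (fun x => f x / g x ^ m) y = 0 := fun y hy => by simp [hf0 y hy]
    rw [pderivPi_eq_zero_of_eqOn_compl hS h0 i x hx,
      pderivPi_eq_zero_of_eqOn_compl hS hf0 i x hx, hf0 x hx]
    simp

theorem integrable_mul_of_eqOn_compl (hS : IsCompact S) {f g : (Fin n → ℝ) → ℂ}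
    (hf : Continuous f) (hg : Continuous g) (hf0 : ∀ x ∉ S, f x = 0) :
    Integrable fun x => f x * g x :=
  (hf.mul hg).integrable_of_hasCompactSupport
    (HasCompactSupport.intro hS fun x hx => by simp [hf0 x hx])

theorem contDiff_cexp_I_mul {ψ : (Fin n → ℝ) → ℝ} (hψ : ContDiff ℝ (⊤ : ℕ∞) ψ) (r : ℝ) :
    ContDiff ℝ (⊤ : ℕ∞) fun x => cexp (I * ((r * ψ x : ℝ) : ℂ)) :=
  (contDiff_const.mul (ofRealCLM.contDiff.comp (contDiff_const.mul hψ))).cexp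

theorem pderivPi_cexp_I_mul {ψ : (Fin n → ℝ) → ℝ} (hψ : ContDiff ℝ (⊤ : ℕ∞) ψ) (r : ℝ)
    (i : Fin n) (x : Fin n → ℝ) :
    pderivPi i (fun x => cexp (I * ((r * ψ x : ℝ) : ℂ))) x =
      I * r * (pderivPi i ψ x : ℝ) * cexp (I * ((r * ψ x : ℝ) : ℂ)) := by
  have hx' : HasFDerivAt ψ (fderiv ℝ ψ x) (Function.update x i (x i)) := by
    simpa using (hψ.differentiable (by simp) x).hasFDerivAt
  have hd := (hx'.comp_hasDerivAt (x i)
    (hasDerivAt_update x i (x i))).differentiableAt.hasDerivAt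
  have := ((((hd.const_mul r).ofReal_comp).const_mul I).cexp).deriv
  refine this.trans ?_
  simp only [Function.comp, Function.update_eq_self]
  push_cast
  change _ * (I * (r * ((pderivPi i ψ x : ℝ) : ℂ))) = _
  ring

/-- Integration by parts against an oscillatory exponential. -/
theorem integral_mul_pderivPi_mul_cexp (hS : IsCompact S) {h : (Fin n → ℝ) → ℂ}
    (hh : ContDiff ℝ (⊤ : ℕ∞) h) (hh0 : ∀ x ∉ S, h x = 0) {ψ : (Fin n → ℝ) → ℝ}
    (hψ : ContDiff ℝ (⊤ : ℕ∞) ψ) (r : ℝ) (i : Fin n) :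
    (r : ℂ) * ∫ x, h x * (pderivPi i ψ x : ℝ) * cexp (I * ((r * ψ x : ℝ) : ℂ)) =
      I * ∫ x, pderivPi i h x * cexp (I * ((r * ψ x : ℝ) : ℂ)) := by
  have he := contDiff_cexp_I_mul hψ r
  have hd : ∀ {f : (Fin n → ℝ) → ℂ}, ContDiff ℝ (⊤ : ℕ∞) f → ∀ x,
      fderiv ℝ f x (Pi.single i 1) = pderivPi i f x := fun hf x =>
    (pderivPi_eq_fderiv (hf.differentiable (by simp) x) i).symm
  have key := integral_mul_fderiv_eq_neg_fderiv_mul_of_integrable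
    (μ := (volume : Measure (Fin n → ℝ))) (v := Pi.single i (1 : ℝ)) (f := h)
    (g := fun x => cexp (I * ((r * ψ x : ℝ) : ℂ)))
    (by simpa only [hd hh] using integrable_mul_of_eqOn_compl hS (hh.pderivPi i).continuous
          he.continuous (pderivPi_eq_zero_of_eqOn_compl hS.isClosed hh0 i))
    (by simpa only [hd he] using integrable_mul_of_eqOn_compl hS hh.continuous
          (he.pderivPi i).continuous hh0)
    (integrable_mul_of_eqOn_compl hS hh.continuous he.continuous hh0)
    (fun x _ => hh.differentiable (by simp) x) (fun x _ => he.differentiable (by simp) x)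
  simp only [hd hh, hd he, pderivPi_cexp_I_mul hψ] at key
  have hI : ∫ x, h x * (I * r * (pderivPi i ψ x : ℝ) * cexp (I * ((r * ψ x : ℝ) : ℂ))) =
      I * (r * ∫ x, h x * (pderivPi i ψ x : ℝ) * cexp (I * ((r * ψ x : ℝ) : ℂ))) := by
    rw [← mul_assoc, ← integral_const_mul]
    congr 1 with x
    ring
  rw [hI] at key
  linear_combination (-I) * key + ((r * ∫ x, h x * (pderivPi i ψ x : ℝ) *
    cexp (I * ((r * ψ x : ℝ) : ℂ)))) * I_mul_I

theorem norm_integral_mul_cexp_le (hS : IsCompact S) {h : (Fin n → ℝ) → ℂ}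
    (hh0 : ∀ x ∉ S, h x = 0) {M : ℝ} (hM : ∀ x ∈ S, ‖h x‖ ≤ M) (φ : (Fin n → ℝ) → ℝ) :
    ‖∫ x, h x * cexp (I * (φ x : ℂ))‖ ≤ M * volume.real S := by
  rw [← setIntegral_eq_integral_of_forall_compl_eq_zero (s := S)
    fun x hx => by rw [hh0 x hx, zero_mul]]
  refine norm_setIntegral_le_of_norm_le_const hS.measure_lt_top fun x hx => ?_
  rw [norm_mul, mul_comm I, norm_exp_ofReal_mul_I, mul_one]
  exact hM x hx

theorem sq_le_norm_sum_sq {p : Fin n → ℝ} {δ : ℝ} (hδ : 0 ≤ δ) (hp : δ ≤ ‖p‖) :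
    δ ^ 2 ≤ ‖∑ i, (p i : ℂ) * (p i : ℂ)‖ := by
  have hsum : ∑ i, (p i : ℂ) * (p i : ℂ) = ((∑ i, p i ^ 2 : ℝ) : ℂ) := by
    push_cast
    simp only [sq]
  have hnn : 0 ≤ ∑ i, p i ^ 2 := Finset.sum_nonneg fun i _ => sq_nonneg (p i)
  rw [hsum, norm_real, Real.norm_of_nonneg hnn]
  refine (Real.le_sqrt hδ hnn).1 (hp.trans ?_)
  refine (pi_norm_le_iff_of_nonneg (Real.sqrt_nonneg _)).2 fun i => ?_
  rw [Real.norm_eq_abs]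
  exact Real.abs_le_sqrt
    (Finset.single_le_sum (f := fun i => p i ^ 2) (fun j _ => sq_nonneg (p j)) (Finset.mem_univ i))

/-- Repeated integration by parts, uniformly over a family of phases `ψ a` whose gradient is
bounded below on `S`. The powers of the squared gradient in the denominator are kept explicit,
so that the amplitudes `f a` stay smooth on the whole space. -/
theorem exists_pow_mul_norm_integral_le {ι : Type*} (hS : IsCompact S) {r : ι → ℝ}
    (hr : ∀ a, 0 ≤ r a) {ψ : ι → (Fin n → ℝ) → ℝ} (hψ : UniformlySmooth S ψ) {δ : ℝ}
    (hδ : 0 < δ) (hgrad : ∀ a, ∀ x ∈ S, δ ≤ ‖fun i => pderivPi i (ψ a) x‖)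
    (N m : ℕ) {f : ι → (Fin n → ℝ) → ℂ} (hf : UniformlySmooth S f)
    (hf0 : ∀ a, ∀ x ∉ S, f a x = 0) :
    ∃ K : ℝ, ∀ a, r a ^ N * ‖∫ x,
      f a x / (∑ i, ((pderivPi i (ψ a) x : ℝ) : ℂ) * ((pderivPi i (ψ a) x : ℝ) : ℂ)) ^ m *
        cexp (I * ((r a * ψ a x : ℝ) : ℂ))‖ ≤ K := by
  have hP : ∀ i, UniformlySmooth S fun a x => ((pderivPi i (ψ a) x : ℝ) : ℂ) :=
    fun i => (hψ.pderivPi i).clm_comp ofRealCLM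
  set g : ι → (Fin n → ℝ) → ℂ :=
    fun a x => ∑ i, ((pderivPi i (ψ a) x : ℝ) : ℂ) * ((pderivPi i (ψ a) x : ℝ) : ℂ)
  have hg : UniformlySmooth S g := UniformlySmooth.sum _ fun i => (hP i).mul (hP i)
  have hglow : ∀ a, ∀ x ∈ S, δ ^ 2 ≤ ‖g a x‖ := fun a x hx =>
    sq_le_norm_sum_sq hδ.le (hgrad a x hx)
  have hg0 : ∀ a, ∀ x ∈ S, g a x ≠ 0 := fun a x hx =>
    norm_pos_iff.1 ((pow_pos hδ 2).trans_le (hglow a x hx))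
  change ∃ K : ℝ, ∀ a, r a ^ N * ‖∫ x, f a x / g a x ^ m *
    cexp (I * ((r a * ψ a x : ℝ) : ℂ))‖ ≤ K
  induction N generalizing m f with
  | zero =>
    obtain ⟨M, hM⟩ := hf.bound 0
    refine ⟨M / (δ ^ 2) ^ m * volume.real S, fun a => ?_⟩
    rw [pow_zero, one_mul]
    refine norm_integral_mul_cexp_le hS (fun x hx => by simp [hf0 a x hx]) (fun x hx => ?_) _
    rw [norm_div, norm_pow]
    have h1 := hM a x hx
    have h2 := hglow a x hx
    have h3 := (norm_nonneg (f a x)).trans h1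
    gcongr
  | succ N ih =>
    have hfP : ∀ i, UniformlySmooth S fun a x => f a x * ((pderivPi i (ψ a) x : ℝ) : ℂ) :=
      fun i => hf.mul (hP i)
    have hfP0 : ∀ i a, ∀ x ∉ S, f a x * ((pderivPi i (ψ a) x : ℝ) : ℂ) = 0 :=
      fun i a x hx => by rw [hf0 a x hx, zero_mul]
    have hdfP0 : ∀ i a, ∀ x ∉ S,
        pderivPi i (fun x => f a x * ((pderivPi i (ψ a) x : ℝ) : ℂ)) x = 0 :=
      fun i a => pderivPi_eq_zero_of_eqOn_compl hS.isClosed (hfP0 i a) i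
    have hfPg0 : ∀ i a, ∀ x ∉ S,
        f a x * ((pderivPi i (ψ a) x : ℝ) : ℂ) * pderivPi i (g a) x = 0 :=
      fun i a x hx => by rw [hfP0 i a x hx, zero_mul]
    choose K₁ hK₁ using fun i => ih (m + 1) ((hfP i).pderivPi i) (hdfP0 i)
    choose K₂ hK₂ using fun i => ih (m + 2) ((hfP i).mul (hg.pderivPi i)) (hfPg0 i)
    refine ⟨∑ i, (K₁ i + (m + 1) * K₂ i), fun a => ?_⟩
    set e : (Fin n → ℝ) → ℂ := fun x => cexp (I * ((r a * ψ a x : ℝ) : ℂ))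
    have he : Continuous e := (contDiff_cexp_I_mul (hψ.contDiff a) (r a)).continuous
    have hint : ∀ {F : (Fin n → ℝ) → ℂ} (k : ℕ), ContDiff ℝ (⊤ : ℕ∞) F → (∀ x ∉ S, F x = 0) →
        Integrable fun x => F x / g a x ^ k * e x := fun k hF hF0 =>
      integrable_mul_of_eqOn_compl hS (contDiff_div_pow_of_eqOn_compl hS.isClosed hF
        (hg.contDiff a) hF0 (hg0 a) k).continuous he fun x hx => by rw [hF0 x hx, zero_div]
    set J₁ : Fin n → ℂ := fun i => ∫ x,
      pderivPi i (fun x => f a x * ((pderivPi i (ψ a) x : ℝ) : ℂ)) x / g a x ^ (m + 1) * e x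
    set J₂ : Fin n → ℂ := fun i => ∫ x,
      f a x * ((pderivPi i (ψ a) x : ℝ) : ℂ) * pderivPi i (g a) x / g a x ^ (m + 2) * e x
    have hparts : ∀ i, (r a : ℂ) * ∫ x, f a x * ((pderivPi i (ψ a) x : ℝ) : ℂ) / g a x ^ (m + 1) *
        ((pderivPi i (ψ a) x : ℝ) : ℂ) * e x = I * (J₁ i - (m + 1) * J₂ i) := by
      intro i
      have hh := contDiff_div_pow_of_eqOn_compl hS.isClosed ((hfP i).contDiff a) (hg.contDiff a)
        (hfP0 i a) (hg0 a) (m + 1)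
      rw [integral_mul_pderivPi_mul_cexp hS hh
        (fun x hx => by rw [hfP0 i a x hx, zero_div]) (hψ.contDiff a) (r a) i]
      congr 1
      simp only [J₁, J₂]
      rw [← integral_const_mul, ← integral_sub
        (hint _ (((hfP i).pderivPi i).contDiff a) (hdfP0 i a))
        ((hint _ (((hfP i).mul (hg.pderivPi i)).contDiff a) (hfPg0 i a)).const_mul _)]
      congr 1 with x
      rw [pderivPi_div_pow_of_eqOn_compl hS.isClosed ((hfP i).contDiff a) (hg.contDiff a)
        (hfP0 i a) (hg0 a)]
      change _ * e x = _
      push_cast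
      ring
    have hsplit : (r a : ℂ) * ∫ x, f a x / g a x ^ m * e x =
        ∑ i, I * (J₁ i - (m + 1) * J₂ i) := by
      rw [← Finset.sum_congr rfl fun i _ => hparts i, ← Finset.mul_sum, ← integral_finsetSum]
      · congr 2 with x
        by_cases hx : x ∈ S
        · have hgx := hg0 a x hx
          have : ∀ i, f a x * ((pderivPi i (ψ a) x : ℝ) : ℂ) / g a x ^ (m + 1) *
              ((pderivPi i (ψ a) x : ℝ) : ℂ) * e x = f a x / g a x ^ (m + 1) * e x *
                (((pderivPi i (ψ a) x : ℝ) : ℂ) * ((pderivPi i (ψ a) x : ℝ) : ℂ)) :=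
            fun i => by ring
          simp only [this]
          rw [← Finset.mul_sum]
          change _ = f a x / g a x ^ (m + 1) * e x * g a x
          field_simp
          ring
        · simp [hf0 a x hx]
      · intro i _
        have := hint (m + 1) (((hfP i).mul (hP i)).contDiff a)
          (fun x hx => by rw [hfP0 i a x hx, zero_mul])
        refine this.congr (.of_forall fun x => ?_)
        dsimp only
        ring
    have hnorm : r a * ‖∫ x, f a x / g a x ^ m * e x‖ ≤ ∑ i, (‖J₁ i‖ + (m + 1) * ‖J₂ i‖) := by
      have : r a * ‖∫ x, f a x / g a x ^ m * e x‖ =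
          ‖(r a : ℂ) * ∫ x, f a x / g a x ^ m * e x‖ := by
        rw [norm_mul, norm_real, Real.norm_of_nonneg (hr a)]
      rw [this, hsplit]
      refine norm_sum_le_of_le _ fun i _ => ?_
      rw [norm_mul, norm_I, one_mul]
      refine (norm_sub_le _ _).trans_eq ?_
      rw [norm_mul]
      norm_cast
    calc r a ^ (N + 1) * ‖∫ x, f a x / g a x ^ m * e x‖
        = r a ^ N * (r a * ‖∫ x, f a x / g a x ^ m * e x‖) := by ring
      _ ≤ r a ^ N * ∑ i, (‖J₁ i‖ + (m + 1) * ‖J₂ i‖) :=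
          mul_le_mul_of_nonneg_left hnorm (pow_nonneg (hr a) N)
      _ = ∑ i, (r a ^ N * ‖J₁ i‖ + (m + 1) * (r a ^ N * ‖J₂ i‖)) := by
          rw [Finset.mul_sum]
          exact Finset.sum_congr rfl fun i _ => by ring
      _ ≤ ∑ i, (K₁ i + (m + 1) * K₂ i) := by
          have h1 : ∀ i, r a ^ N * ‖J₁ i‖ ≤ K₁ i := fun i => hK₁ i a
          have h2 : ∀ i, r a ^ N * ‖J₂ i‖ ≤ K₂ i := fun i => hK₂ i a
          gcongr with i
          · exact h1 i
          · exact h2 i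

end OscillatoryIntegral

/-- **Non-stationary phase kernel decay.** Let `S, V ⊂ ℝ²` be compact, `c > 0`, and
`C_α ≥ 0`. Suppose `Υ(x,v)` is smooth in `x` and on `S × V × V` satisfies
`|∇_x[Υ(x,v) − Υ(x,w)]| ≥ c|v − w|` and `|∂_x^α[Υ(x,v) − Υ(x,w)]| ≤ C_α|v − w|`. Then for
every positive integer `j` there is `C_j` such that for every `λ ≥ 1`, all amplitudes
`B, B̃` smooth in `x`, supported in `S × V`, with `x`-derivatives bounded by the `C_α`,
and all `v, w ∈ V`:
`|∫ B(x,v) conj(B̃(x,w)) e^{iλ[Υ(x,v)−Υ(x,w)]} dx| ≤ C_j (1 + λ|v−w|)^{−2j}`. -/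
theorem nonstationary_phase_kernel_decay
    (S V : Set (Fin 2 → ℝ)) (hS : IsCompact S) (hV : IsCompact V)
    (c : ℝ) (hc : 0 < c) (C : (Fin 2 → ℕ) → ℝ) (hCnn : ∀ α, 0 ≤ C α)
    (Υ : (Fin 2 → ℝ) → (Fin 2 → ℝ) → ℝ)
    (hsmooth : ∀ v : Fin 2 → ℝ, ContDiff ℝ (⊤ : ℕ∞) (fun x => Υ x v))
    (hlow : ∀ x ∈ S, ∀ v ∈ V, ∀ w ∈ V,
      c * ‖v - w‖ ≤ ‖(fun i : Fin 2 => pderivPi i (fun x' => Υ x' v - Υ x' w) x : Fin 2 → ℝ)‖)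
    (hupp : ∀ (α : Fin 2 → ℕ), ∀ x ∈ S, ∀ v ∈ V, ∀ w ∈ V,
      ‖mpderivPi α (fun x' => Υ x' v - Υ x' w) x‖ ≤ C α * ‖v - w‖) :
    ∀ j : ℕ, 0 < j → ∃ Cj : ℝ,
      ∀ lam : ℝ, 1 ≤ lam →
      ∀ B B' : (Fin 2 → ℝ) → (Fin 2 → ℝ) → ℂ,
        (∀ v : Fin 2 → ℝ, ContDiff ℝ (⊤ : ℕ∞) (fun x => B x v)) →
        (∀ v : Fin 2 → ℝ, ContDiff ℝ (⊤ : ℕ∞) (fun x => B' x v)) →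
        (∀ x v : Fin 2 → ℝ, x ∉ S ∨ v ∉ V → B x v = 0) →
        (∀ x v : Fin 2 → ℝ, x ∉ S ∨ v ∉ V → B' x v = 0) →
        (∀ (α : Fin 2 → ℕ) (x v : Fin 2 → ℝ), ‖mpderivPi α (fun x' => B x' v) x‖ ≤ C α) →
        (∀ (α : Fin 2 → ℕ) (x v : Fin 2 → ℝ), ‖mpderivPi α (fun x' => B' x' v) x‖ ≤ C α) →
      ∀ v ∈ V, ∀ w ∈ V,
        ‖∫ x : Fin 2 → ℝ, B x v * (starRingEnd ℂ) (B' x w) *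
            Complex.exp (Complex.I * ((lam * (Υ x v - Υ x w) : ℝ) : ℂ))‖ ≤
          Cj * (1 + lam * ‖v - w‖) ^ (-(2 * (j : ℝ))) := by
  intro j _
  let X := Fin 2 → ℝ
  let Admissible : (X → X → ℂ) → Prop := fun B =>
    (∀ v : X, ContDiff ℝ (⊤ : ℕ∞) (fun x => B x v)) ∧
    (∀ x v : X, x ∉ S ∨ v ∉ V → B x v = 0) ∧
    (∀ (α : Fin 2 → ℕ) (x v : X), ‖mpderivPi α (fun x' => B x' v) x‖ ≤ C α)
  let ι := {p : (ℝ × X × X) × (X → X → ℂ) × (X → X → ℂ) //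
    (1 ≤ p.1.1 ∧ p.1.2.1 ∈ V ∧ p.1.2.2 ∈ V ∧ p.1.2.1 ≠ p.1.2.2) ∧
      Admissible p.2.1 ∧ Admissible p.2.2}
  let dist : ι → ℝ := fun p => ‖p.1.1.2.1 - p.1.1.2.2‖
  let r : ι → ℝ := fun p => p.1.1.1 * dist p
  let ψ : ι → X → ℝ := fun p x => (dist p)⁻¹ • (Υ x p.1.1.2.1 - Υ x p.1.1.2.2)
  let f : ι → X → ℂ := fun p x => p.1.2.1 x p.1.1.2.1 * (starRingEnd ℂ) (p.1.2.2 x p.1.1.2.2)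
  have hdist : ∀ p, 0 < dist p := fun p => norm_pos_iff.2 (sub_ne_zero.2 p.2.1.2.2.2)
  have hr : ∀ p, 0 ≤ r p := fun p =>
    mul_nonneg (zero_le_one.trans p.2.1.1) (hdist p).le
  have hψ : UniformlySmooth S ψ := by
    refine UniformlySmooth.of_mpderivPi
      (fun p => ((hsmooth p.1.1.2.1).sub (hsmooth p.1.1.2.2)).const_smul (dist p)⁻¹) C
      fun α p x hx => ?_
    rw [mpderivPi_const_smul, norm_smul, norm_inv, Real.norm_of_nonneg (hdist p).le,
      inv_mul_le_iff₀ (hdist p), mul_comm]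
    exact hupp α x hx _ p.2.1.2.1 _ p.2.1.2.2.1
  have hgrad : ∀ p, ∀ x ∈ S, c ≤ ‖fun i => pderivPi i (ψ p) x‖ := by
    intro p x hx
    have hsmul : (fun i => pderivPi i (ψ p) x) = (dist p)⁻¹ •
        fun i => pderivPi i (fun x' => Υ x' p.1.1.2.1 - Υ x' p.1.1.2.2) x := by
      funext i
      exact congrFun (pderivPi_const_smul _ _ i) x
    rw [hsmul, norm_smul, norm_inv, Real.norm_of_nonneg (hdist p).le,
      le_inv_mul_iff₀ (hdist p), mul_comm]
    exact hlow x hx _ p.2.1.2.1 _ p.2.1.2.2.1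
  have hf : UniformlySmooth S f := by
    have hB : UniformlySmooth S fun (p : ι) x => p.1.2.1 x p.1.1.2.1 :=
      .of_mpderivPi (fun p => p.2.2.1.1 _) C fun α p x _ => p.2.2.1.2.2 α x _
    have hB' : UniformlySmooth S fun (p : ι) x => p.1.2.2 x p.1.1.2.2 :=
      .of_mpderivPi (fun p => p.2.2.2.1 _) C fun α p x _ => p.2.2.2.2.2 α x _
    exact hB.mul (hB'.clm_comp (Complex.conjCLE : ℂ →L[ℝ] ℂ))
  have hf0 : ∀ p, ∀ x ∉ S, f p x = 0 := fun p x hx => by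
    simp only [f, p.2.2.1.2.1 x _ (Or.inl hx), zero_mul]
  obtain ⟨K, hK⟩ := exists_pow_mul_norm_integral_le hS hr hψ hc hgrad (2 * j) 0 hf hf0
  let K₀ := C 0 * C 0 * volume.real S
  refine ⟨2 ^ (2 * j) * max K₀ K, ?_⟩
  intro lam hlam B B' hB hB' hB0 hB0' hBC hBC' v hv w hw
  set I := ‖∫ x : Fin 2 → ℝ, B x v * (starRingEnd ℂ) (B' x w) *
    Complex.exp (Complex.I * ((lam * (Υ x v - Υ x w) : ℝ) : ℂ))‖
  set t := lam * ‖v - w‖ with ht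
  have ht0 : 0 ≤ t := mul_nonneg (zero_le_one.trans hlam) (norm_nonneg _)
  have htrivial : I ≤ K₀ := by
    refine norm_integral_mul_cexp_le hS (fun x hx => by rw [hB0 x v (Or.inl hx), zero_mul])
      (fun x _ => norm_mul_le_of_le ?_ ?_) _
    · simpa [mpderivPi_two] using hBC 0 x v
    · simpa [mpderivPi_two] using hBC' 0 x w
  have hdecay : 0 < t → t ^ (2 * j) * I ≤ K := by
    intro htpos
    have hvw : v ≠ w := by
      rintro rfl
      simp [ht] at htpos
    have hne : ‖v - w‖ ≠ 0 := norm_ne_zero_iff.2 (sub_ne_zero.2 hvw)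
    have h := hK ⟨((lam, v, w), B, B'), ⟨hlam, hv, hw, hvw⟩, ⟨hB, hB0, hBC⟩, ⟨hB', hB0', hBC'⟩⟩
    simp only [pow_zero, div_one, f, r, ψ, dist, smul_eq_mul] at h
    have hphase : ∀ x, lam * ‖v - w‖ * (‖v - w‖⁻¹ * (Υ x v - Υ x w)) =
        lam * (Υ x v - Υ x w) := fun x => by field_simp
    simpa only [hphase] using h
  have hmain : (1 + t) ^ (2 * j) * I ≤ 2 ^ (2 * j) * max K₀ K := by
    rcases le_total t 1 with h1 | h1
    · have h2 : (1 + t) ^ (2 * j) ≤ 2 ^ (2 * j) := by gcongr; linarith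
      exact mul_le_mul h2 (htrivial.trans (le_max_left _ _)) (norm_nonneg _) (by positivity)
    · have h2 : (1 + t) ^ (2 * j) ≤ 2 ^ (2 * j) * t ^ (2 * j) := by
        rw [← mul_pow]
        gcongr
        linarith
      calc (1 + t) ^ (2 * j) * I ≤ 2 ^ (2 * j) * t ^ (2 * j) * I :=
            mul_le_mul_of_nonneg_right h2 (norm_nonneg _)
        _ = 2 ^ (2 * j) * (t ^ (2 * j) * I) := mul_assoc _ _ _
        _ ≤ 2 ^ (2 * j) * max K₀ K := by
            gcongr
            exact (hdecay (by linarith)).trans (le_max_right _ _)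
  have hrpow : (1 + t) ^ (-(2 * (j : ℝ))) = ((1 + t) ^ (2 * j))⁻¹ := by
    rw [Real.rpow_neg (by linarith), ← Real.rpow_natCast]
    push_cast
    rfl
  rw [hrpow, ← div_eq_mul_inv, le_div_iff₀ (by positivity), mul_comm]
  exact hmain
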